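/- Let N ≥ 1, let 0 ≤ β_1 < β_0 be reals, and let Y : ℕ^N → [0,1]. For every \vec f ∈ {0,1}^N define the gain G_{\vec f} = (∏_{i=0}^{N−1} e^{−β_{f_i}}) · Σ_{(n_0,…,n_{N−1}) ∈ ℕ^N} [Y(n_0,…,n_{N−1}) / (n_0!·…·n_{N−1}!)] · ∏_{i=0}^{N−1} β_{f_i}^{n_i}. Fix (n_0,…,n_{N−1}) ∈ ℕ^N, let \vec h ∈ {0,1}^N be defined by h_i = 1 if n_i ≥ 1 and h_i = 0 if n_i = 0, let m = |\vec h|, and set B_{\vec h} = Σ_{\vec f ∈ {0,1}^N} (−1)^{|\vec f|} · β_0^{(\vec 1 − \vec h)·\vec f} · β_1^{(\vec 1 − \vec h)·(\vec 1 − \vec f)} · G_{\vec f} / ∏_{i=0}^{N−1} e^{−β_{f_i}}. Then Y(n_0,…,n_{N−1}) ≤ [ ∏_{i : n_i ≠ 0} n_i! / (β_0^{n_i} − β_1^{n_i}) ] · [ (−1)^{N−m}·B_{\vec h}/(β_0 − β_1)^{N−m} + (e^{β_0} − e^{β_1})^m · Σ_{k=0}^{⌊(N−m−1)/2⌋} C(N−m,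 2k+1) · ( (β_1·e^{β_0} − β_0·e^{β_1} + β_0 − β_1)/(β_0 − β_1) )^{2k+1} ]. -/

import Mathlib

/-- Hamming weight of a binary vector encoded as `Fin N → Bool`. -/
def hamW {N : ℕ} (h : Fin N → Bool) : ℕ := (Finset.univ.filter fun i => h i = true).card

/-- The gain `G_f` when party `i` sends a phase-randomized coherent state of intensity
`β_{f_i}` (`b1` if `f i = true`, else `b0`), for yields `Y`. -/
noncomputable def gain (N : ℕ) (b0 b1 : ℝ) (Y : (Fin N → ℕ) → ℝ)
    (f : Fin N → Bool) : ℝ :=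
  (∏ i : Fin N, Real.exp (-(if f i then b1 else b0))) *
    ∑' n : Fin N → ℕ,
      (Y n / ∏ i, (Nat.factorial (n i) : ℝ)) * ∏ i, (if f i then b1 else b0) ^ (n i)

/-- The decoy combination `B_h` of the rescaled gains. -/
noncomputable def decoyB (N : ℕ) (b0 b1 : ℝ) (Y : (Fin N → ℕ) → ℝ)
    (h : Fin N → Bool) : ℝ :=
  ∑ f : Fin N → Bool,
    (-1 : ℝ) ^ (∑ i, (f i).toNat) *
      b0 ^ (∑ i, (1 - (h i).toNat) * (f i).toNat) *
      b1 ^ (∑ i, (1 - (h i).toNat) * (1 - (f i).toNat)) *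
      (gain N b0 b1 Y f / ∏ i : Fin N, Real.exp (-(if f i then b1 else b0)))

/-- The coefficient with which the photon number `k` of one party enters the normalized decoy
combination `(-1)^{N-m} B_h / (β_0 - β_1)^{N-m}`. -/
noncomputable def decoyWeight (b0 b1 : ℝ) (h : Bool) (k : ℕ) : ℝ :=
  (if h then b0 ^ k - b1 ^ k else (b0 * b1 ^ k - b1 * b0 ^ k) / (b0 - b1)) / (Nat.factorial k : ℝ)

lemma hasSum_mul_real {ι κ : Type*} {f : ι → ℝ} {g : κ → ℝ} {a b : ℝ}
    (hf : HasSum f a) (hg : HasSum g b) :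
    HasSum (fun x : ι × κ => f x.1 * g x.2) (a * b) := by
  have hf' : Summable fun x => ‖f x‖ := hf.summable.norm
  have hg' : Summable fun x => ‖g x‖ := hg.summable.norm
  have hfg : Summable fun x : ι × κ => f x.1 * g x.2 := summable_mul_of_summable_norm hf' hg'
  exact hf.mul hg hfg

lemma hasSum_prod_fin_pi {κ : Type*} {N : ℕ} {g : Fin N → κ → ℝ} {s : Fin N → ℝ}
    (hg : ∀ i, HasSum (g i) (s i)) :
    HasSum (fun n : Fin N → κ => ∏ i, g i (n i)) (∏ i, s i) := by
  induction N with
  | zero => simp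
  | succ N ih =>
    have htail := ih fun i => hg i.succ
    have hmul := hasSum_mul_real (hg 0) htail
    rw [Fin.prod_univ_succ, ← (Fin.consEquiv fun _ => κ).hasSum_iff]
    convert! hmul using 2 with x
    simp [Fin.consEquiv, Fin.prod_univ_succ]

lemma sum_odd_choose_mul_pow {R : Type*} [Field R] [CharZero R] (M : ℕ) (x : R) :
    ∑ k ∈ Finset.range ((M - 1) / 2 + 1), (Nat.choose M (2 * k + 1) : R) * x ^ (2 * k + 1) =
      ((1 + x) ^ M - (1 - x) ^ M) / 2 := by
  have expand : ∀ y : R, ∀ L, M ≤ L →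
      (1 + y) ^ M = ∑ j ∈ Finset.range (L + 1), y ^ j * (Nat.choose M j : R) := by
    intro y L hL
    rw [add_comm, add_pow]
    simp only [one_pow, mul_one]
    refine Finset.sum_subset (Finset.range_mono (by omega)) fun j _ hj => ?_
    rw [Nat.choose_eq_zero_of_lt (by simpa [Nat.lt_succ_iff] using hj)]
    simp
  have split : ∀ (g : ℕ → R) (K : ℕ), ∑ j ∈ Finset.range (2 * K + 1), g j =
      ∑ k ∈ Finset.range (K + 1), g (2 * k) + ∑ k ∈ Finset.range K, g (2 * k + 1) := by
    intro g K
    induction K with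
    | zero => simp
    | succ K ih =>
      rw [show 2 * (K + 1) + 1 = 2 * K + 1 + 1 + 1 by ring, Finset.sum_range_succ,
        Finset.sum_range_succ, ih, Finset.sum_range_succ _ (K + 1), Finset.sum_range_succ _ K]
      rw [Finset.sum_range_succ _ K, show 2 * (K + 1) = 2 * K + 1 + 1 by ring]
      ring
  have hL : M ≤ 2 * ((M - 1) / 2 + 1) := by omega
  rw [sub_eq_add_neg 1 x, expand x _ hL, expand (-x) _ hL, split, split]
  simp only [(even_two_mul _).neg_pow, (odd_two_mul_add_one _).neg_pow, neg_mul,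
    Finset.sum_neg_distrib, mul_comm (Nat.choose M _ : R)]
  rw [eq_div_iff two_ne_zero]
  ring

lemma decoyWeight_true_nonneg {b0 b1 : ℝ} (hb1 : 0 ≤ b1) (hb : b1 < b0) (k : ℕ) :
    0 ≤ decoyWeight b0 b1 true k := by
  have : b1 ^ k ≤ b0 ^ k := by gcongr
  simp only [decoyWeight, if_true]
  exact div_nonneg (by linarith) (by positivity)

lemma decoyWeight_false_zero {b0 b1 : ℝ} (hb : b1 < b0) : decoyWeight b0 b1 false 0 = 1 := by
  simp [decoyWeight, div_self (sub_pos.2 hb).ne']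

lemma decoyWeight_false_nonpos {b0 b1 : ℝ} (hb1 : 0 ≤ b1) (hb : b1 < b0) {k : ℕ} (hk : k ≠ 0) :
    decoyWeight b0 b1 false k ≤ 0 := by
  obtain ⟨k, rfl⟩ := Nat.exists_eq_succ_of_ne_zero hk
  have hpow : b1 ^ k ≤ b0 ^ k := by gcongr
  have hnum : b0 * b1 ^ (k + 1) - b1 * b0 ^ (k + 1) ≤ 0 := by
    have := mul_le_mul_of_nonneg_left hpow (mul_nonneg (hb1.trans hb.le) hb1)
    rw [pow_succ, pow_succ]
    linarith
  simp only [decoyWeight, Bool.false_eq_true, if_false]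
  exact div_nonpos_of_nonpos_of_nonneg
    (div_nonpos_of_nonpos_of_nonneg hnum (sub_pos.2 hb).le) (by positivity)

lemma hasSum_pow_div_factorial (x : ℝ) :
    HasSum (fun k : ℕ => x ^ k / (Nat.factorial k : ℝ)) (Real.exp x) := by
  rw [Real.exp_eq_exp_ℝ]
  exact NormedSpace.expSeries_div_hasSum_exp x

lemma hasSum_decoyWeight_true (b0 b1 : ℝ) :
    HasSum (decoyWeight b0 b1 true) (Real.exp b0 - Real.exp b1) := by
  convert! (hasSum_pow_div_factorial b0).sub (hasSum_pow_div_factorial b1) using 2 with k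
  simp [decoyWeight, sub_div]

lemma hasSum_decoyWeight_false (b0 b1 : ℝ) (hb : b1 < b0) :
    HasSum (decoyWeight b0 b1 false)
      (1 - (b1 * Real.exp b0 - b0 * Real.exp b1 + b0 - b1) / (b0 - b1)) := by
  have hne := (sub_pos.2 hb).ne'
  convert! (((hasSum_pow_div_factorial b1).mul_left b0).sub
    ((hasSum_pow_div_factorial b0).mul_left b1)).div_const (b0 - b1) using 1
  · funext k
    simp only [decoyWeight, Bool.false_eq_true, if_false]
    ring
  · field_simp
    ring

lemma hasSum_abs_decoyWeight_false (b0 b1 : ℝ) (hb1 : 0 ≤ b1) (hb : b1 < b0) :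
    HasSum (fun k => |decoyWeight b0 b1 false k|)
      (1 + (b1 * Real.exp b0 - b0 * Real.exp b1 + b0 - b1) / (b0 - b1)) := by
  have hpoint : (fun k => |decoyWeight b0 b1 false k|) =
      fun k => (if k = 0 then (2 : ℝ) else 0) - decoyWeight b0 b1 false k := by
    funext k
    rcases eq_or_ne k 0 with rfl | hk
    · norm_num [decoyWeight_false_zero hb]
    · rw [abs_of_nonpos (decoyWeight_false_nonpos hb1 hb hk), if_neg hk, zero_sub]
  rw [hpoint]
  convert! (hasSum_ite_eq 0 (2 : ℝ)).sub (hasSum_decoyWeight_false b0 b1 hb) using 1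
  ring

lemma prod_ite_eq_pow_hamW {N : ℕ} (h : Fin N → Bool) (a c : ℝ) :
    ∏ i, (if h i then a else c) = a ^ hamW h * c ^ (N - hamW h) := by
  have hcard := Finset.card_filter_add_card_filter_not
    (s := (Finset.univ : Finset (Fin N))) (fun i => h i = true)
  rw [Finset.card_univ, Fintype.card_fin] at hcard
  rw [Finset.prod_ite, Finset.prod_const, Finset.prod_const, hamW]
  congr 2
  omega

/-- The unnormalized series behind each gain converges. -/
lemma summable_gain_series {N : ℕ} {Y : (Fin N → ℕ) → ℝ} (hY : ∀ n, Y n ∈ Set.Icc (0 : ℝ) 1)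
    {b : Fin N → ℝ} (hb : ∀ i, 0 ≤ b i) :
    Summable fun n : Fin N → ℕ =>
      (Y n / ∏ i, (Nat.factorial (n i) : ℝ)) * ∏ i, b i ^ n i := by
  have hexp := (hasSum_prod_fin_pi fun i => hasSum_pow_div_factorial (b i)).summable
  refine hexp.of_nonneg_of_le (fun n => ?_) fun n => ?_
  · exact mul_nonneg (div_nonneg (hY n).1 (by positivity))
      (Finset.prod_nonneg fun i _ => pow_nonneg (hb i) _)
  · rw [Finset.prod_div_distrib, div_mul_eq_mul_div]
    gcongr
    exact mul_le_of_le_one_left (Finset.prod_nonneg fun i _ => pow_nonneg (hb i) _) (hY n).2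

/-- The normalized decoy combination as a series in the yields. -/
lemma hasSum_decoyB {N : ℕ} {b0 b1 : ℝ} (hb1 : 0 ≤ b1) (hb : b1 < b0)
    {Y : (Fin N → ℕ) → ℝ} (hY : ∀ n, Y n ∈ Set.Icc (0 : ℝ) 1) (h : Fin N → Bool) :
    HasSum (fun n => Y n * ∏ i, decoyWeight b0 b1 (h i) (n i))
      ((-1 : ℝ) ^ (N - hamW h) * decoyB N b0 b1 Y h / (b0 - b1) ^ (N - hamW h)) := by
  have hne := (sub_pos.2 hb).ne'
  have hgain : ∀ f : Fin N → Bool,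
      HasSum (fun n : Fin N → ℕ => (Y n / ∏ i, (Nat.factorial (n i) : ℝ)) *
          ∏ i, (if f i then b1 else b0) ^ n i)
        (gain N b0 b1 Y f / ∏ i : Fin N, Real.exp (-(if f i then b1 else b0))) := by
    intro f
    rw [gain, mul_div_cancel_left₀ _ (Finset.prod_ne_zero_iff.2 fun i _ => (Real.exp_pos _).ne')]
    refine (summable_gain_series hY fun i => ?_).hasSum
    split_ifs <;> linarith
  have hB := (hasSum_sum fun f (_ : f ∈ (Finset.univ : Finset (Fin N → Bool))) =>
    (hgain f).mul_left ((-1 : ℝ) ^ (∑ i, (f i).toNat) *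
      b0 ^ (∑ i, (1 - (h i).toNat) * (f i).toNat) *
      b1 ^ (∑ i, (1 - (h i).toNat) * (1 - (f i).toNat))))
  have hscale := hB.mul_left (∏ i, if h i then (1 : ℝ) else -1 / (b0 - b1))
  convert! hscale using 1
  · funext n
    have hsum : ∀ i, decoyWeight b0 b1 (h i) (n i) =
        (if h i then (1 : ℝ) else -1 / (b0 - b1)) * ((∑ c : Bool,
          (-1 : ℝ) ^ c.toNat * b0 ^ ((1 - (h i).toNat) * c.toNat) *
            b1 ^ ((1 - (h i).toNat) * (1 - c.toNat)) * (if c then b1 else b0) ^ n i) /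
          (Nat.factorial (n i) : ℝ)) := by
      intro i
      cases h i
      · simp [decoyWeight]
        field_simp
        ring
      · simp [decoyWeight]
        ring
    simp only [hsum]
    rw [Finset.prod_mul_distrib, Finset.prod_div_distrib, Fintype.prod_sum, mul_left_comm]
    congr 1
    rw [Finset.sum_div, Finset.mul_sum]
    refine Finset.sum_congr rfl fun f _ => ?_
    simp only [Finset.prod_mul_distrib, Finset.prod_pow_eq_pow_sum]
    ring
  · rw [prod_ite_eq_pow_hamW, one_pow, one_mul, div_pow, decoyB]
    ring

/-- Analytical upper bound of the multipartite decoy-state method with two decoy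
intensities `0 ≤ β_1 < β_0` per party: for any photon numbers `n` with associated
binary vector `h` (`h_i = 1` iff `n_i ≥ 1`) of weight `m`,
`Y(n) ≤ ∏_{n_i≠0} n_i!/(β_0^{n_i}-β_1^{n_i}) · [(-1)^{N-m} B_h/(β_0-β_1)^{N-m}
  + (e^{β_0}-e^{β_1})^m ∑_{k=0}^{⌊(N-m-1)/2⌋} C(N-m,2k+1)
      ((β_1 e^{β_0}-β_0 e^{β_1}+β_0-β_1)/(β_0-β_1))^{2k+1}]`. -/
theorem decoy_yield_upper_bound (N : ℕ) (hN : 1 ≤ N) (b0 b1 : ℝ)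
    (hb1 : 0 ≤ b1) (hb : b1 < b0)
    (Y : (Fin N → ℕ) → ℝ) (hY : ∀ n, Y n ∈ Set.Icc (0 : ℝ) 1)
    (n : Fin N → ℕ) (h : Fin N → Bool) (hh : ∀ i, h i = true ↔ n i ≠ 0) :
    Y n ≤
      (∏ i ∈ Finset.univ.filter fun i => n i ≠ 0,
          (Nat.factorial (n i) : ℝ) / (b0 ^ (n i) - b1 ^ (n i))) *
        ((-1 : ℝ) ^ (N - hamW h) * decoyB N b0 b1 Y h / (b0 - b1) ^ (N - hamW h) +
          (Real.exp b0 - Real.exp b1) ^ hamW h *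
            ∑ k ∈ Finset.range ((N - hamW h - 1) / 2 + 1),
              (Nat.choose (N - hamW h) (2 * k + 1) : ℝ) *
                ((b1 * Real.exp b0 - b0 * Real.exp b1 + b0 - b1) / (b0 - b1)) ^
                  (2 * k + 1)) := by
  set D := (b1 * Real.exp b0 - b0 * Real.exp b1 + b0 - b1) / (b0 - b1)
  have hB := hasSum_decoyB hb1 hb hY h
  have hW : HasSum (fun n' : Fin N → ℕ => ∏ i, decoyWeight b0 b1 (h i) (n' i))
      ((Real.exp b0 - Real.exp b1) ^ hamW h * (1 - D) ^ (N - hamW h)) := by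
    rw [← prod_ite_eq_pow_hamW]
    refine hasSum_prod_fin_pi fun i => ?_
    cases h i
    · exact hasSum_decoyWeight_false b0 b1 hb
    · exact hasSum_decoyWeight_true b0 b1
  have hA : HasSum (fun n' : Fin N → ℕ => |∏ i, decoyWeight b0 b1 (h i) (n' i)|)
      ((Real.exp b0 - Real.exp b1) ^ hamW h * (1 + D) ^ (N - hamW h)) := by
    simp only [Finset.abs_prod]
    rw [← prod_ite_eq_pow_hamW]
    refine hasSum_prod_fin_pi (g := fun i k => |decoyWeight b0 b1 (h i) k|) fun i => ?_
    cases h i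
    · exact hasSum_abs_decoyWeight_false b0 b1 hb1 hb
    · simp only [abs_of_nonneg (decoyWeight_true_nonneg hb1 hb _)]
      exact hasSum_decoyWeight_true b0 b1
  have hWn : ∏ i, decoyWeight b0 b1 (h i) (n i) =
      ∏ i ∈ Finset.univ.filter fun i => n i ≠ 0,
        (b0 ^ n i - b1 ^ n i) / (Nat.factorial (n i) : ℝ) := by
    rw [Finset.prod_filter]
    refine Finset.prod_congr rfl fun i _ => ?_
    by_cases hi : n i = 0
    · have : h i = false := by simpa [hi] using hh i
      simp [hi, this, decoyWeight_false_zero hb]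
    · simp [hi, (hh i).2 hi, decoyWeight]
  have hWn_pos : 0 < ∏ i, decoyWeight b0 b1 (h i) (n i) := by
    rw [hWn]
    refine Finset.prod_pos fun i hi => div_pos (sub_pos.2 ?_) (by positivity)
    exact pow_lt_pow_left₀ hb hb1 (Finset.mem_filter.1 hi).2
  have hterm := le_hasSum ((hB.sub (hW.div_const 2)).add (hA.div_const 2)) n fun n' _ => by
    obtain ⟨h0, h1⟩ := hY n'
    rcases abs_cases (∏ i, decoyWeight b0 b1 (h i) (n' i)) with ⟨he, hs⟩ | ⟨he, hs⟩
    · rw [he]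
      nlinarith
    · rw [he]
      nlinarith
  rw [abs_of_pos hWn_pos] at hterm
  have hinv : (∏ i ∈ Finset.univ.filter fun i => n i ≠ 0,
      (Nat.factorial (n i) : ℝ) / (b0 ^ n i - b1 ^ n i)) =
        (∏ i, decoyWeight b0 b1 (h i) (n i))⁻¹ := by
    rw [hWn, ← Finset.prod_inv_distrib]
    simp only [inv_div]
  rw [hinv, inv_mul_eq_div, le_div_iff₀ hWn_pos, sum_odd_choose_mul_pow]
  linarith
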